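/- arXiv:1709.02423 — 2 statements merged into one kernel-verified Lean document; each statement's English description precedes it below -/
import Mathlib

section
/- Let A_1,…,A_m be real symmetric n×n matrices with 𝒜*(Y) = (A_1•Y, …, A_m•Y), and suppose Z = diag(I_r, 0) is a maximum rank slack of the homogeneous system (P_SDH): Σ x_i A_i ⪯ 0. Then: (1) 𝒜*(PSD^n) is not closed if and only if (P_SDH) has an elementary reformulation in bad normal form; (2) 𝒜*(PSD^n) is closed if and only if (P_SDH) has an elementary reformulation in good normal form. -/
open Matrix

/-- Trace inner product `S • T = trace(ST)` of square real matrices. -/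
noncomputable def ip {k : ℕ} (S T : Matrix (Fin k) (Fin k) ℝ) : ℝ :=
  Matrix.trace (S * T)

/-- `x` is feasible for the semidefinite system `∑ xᵢ Aᵢ ⪯ B`. -/
def IsFeasible {n m : ℕ} (A : Fin m → Matrix (Fin n) (Fin n) ℝ)
    (B : Matrix (Fin n) (Fin n) ℝ) (x : Fin m → ℝ) : Prop :=
  (B - ∑ i, x i • A i).PosSemidef

/-- The set of primal objective values `∑ cᵢ xᵢ` over feasible `x`. -/
def PrimalVals {n m : ℕ} (A : Fin m → Matrix (Fin n) (Fin n) ℝ)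
    (B : Matrix (Fin n) (Fin n) ℝ) (c : Fin m → ℝ) : Set ℝ :=
  {s | ∃ x : Fin m → ℝ, IsFeasible A B x ∧ s = ∑ i, c i * x i}

/-- The system `∑ xᵢ Aᵢ ⪯ B` is badly behaved: for some `c` the primal optimal
value is finite (i.e. is a least upper bound `v`), but no dual feasible `Y`
achieves value `v`. -/
def BadlyBehaved {n m : ℕ} (A : Fin m → Matrix (Fin n) (Fin n) ℝ)
    (B : Matrix (Fin n) (Fin n) ℝ) : Prop :=
  ∃ (c : Fin m → ℝ) (v : ℝ), IsLUB (PrimalVals A B c) v ∧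
    ¬ ∃ Y : Matrix (Fin n) (Fin n) ℝ,
        Y.PosSemidef ∧ (∀ i, ip (A i) Y = c i) ∧ ip B Y = v

/-- `Zmat n r = diag(I_r, 0)`. -/
def Zmat (n r : ℕ) : Matrix (Fin n) (Fin n) ℝ :=
  Matrix.of fun i j => if i = j ∧ (i : ℕ) < r then (1 : ℝ) else 0

/-- `Zmat n r` is a maximum rank slack of `∑ xᵢ Aᵢ ⪯ B`:
it is a slack and every slack has rank at most `r`. -/
def MaxRankSlack {n m : ℕ} (A : Fin m → Matrix (Fin n) (Fin n) ℝ)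
    (B : Matrix (Fin n) (Fin n) ℝ) (r : ℕ) : Prop :=
  (∃ x : Fin m → ℝ, B - ∑ i, x i • A i = Zmat n r) ∧
  ∀ x : Fin m → ℝ, IsFeasible A B x → (B - ∑ i, x i • A i).rank ≤ r

/-- Lower-right `(n-r) × (n-r)` block. -/
def block22 {n : ℕ} (r : ℕ) (h : r ≤ n) (V : Matrix (Fin n) (Fin n) ℝ) :
    Matrix (Fin (n - r)) (Fin (n - r)) ℝ :=
  Matrix.of fun i j => V ⟨r + i.1, by omega⟩ ⟨r + j.1, by omega⟩

/-- Upper-right `r × (n-r)` block. -/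
def block12 {n : ℕ} (r : ℕ) (h : r ≤ n) (V : Matrix (Fin n) (Fin n) ℝ) :
    Matrix (Fin r) (Fin (n - r)) ℝ :=
  Matrix.of fun i j => V ⟨i.1, by omega⟩ ⟨r + j.1, by omega⟩

/-- The column space (range space) of a matrix. -/
def colSpace {p q : ℕ} (M : Matrix (Fin p) (Fin q) ℝ) : Submodule ℝ (Fin p → ℝ) :=
  LinearMap.range M.mulVecLin

/-- The "Bad condition": some linear combination `V` of the `Aᵢ` has `V₂₂ ⪰ 0`
and `ℛ(V₁₂ᵀ) ⊄ ℛ(V₂₂)`. -/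
def BadCond {n m : ℕ} (A : Fin m → Matrix (Fin n) (Fin n) ℝ) (r : ℕ) (h : r ≤ n) : Prop :=
  ∃ lam : Fin m → ℝ,
    (block22 r h (∑ i, lam i • A i)).PosSemidef ∧
    ¬ colSpace (block12 r h (∑ i, lam i • A i))ᵀ ≤
        colSpace (block22 r h (∑ i, lam i • A i))

/-- `padLow r h U = diag(0, U)` as an `n × n` matrix. -/
def padLow {n : ℕ} (r : ℕ) (h : r ≤ n) (U : Matrix (Fin (n - r)) (Fin (n - r)) ℝ) :
    Matrix (Fin n) (Fin n) ℝ :=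
  Matrix.of fun a b =>
    if hab : r ≤ (a : ℕ) ∧ r ≤ (b : ℕ) then U ⟨a.1 - r, by omega⟩ ⟨b.1 - r, by omega⟩
    else 0

/-- "Good condition 1": some positive definite `U` has `Aᵢ • diag(0, U) = 0` for all `i`. -/
def GoodCond1 {n m : ℕ} (A : Fin m → Matrix (Fin n) (Fin n) ℝ) (r : ℕ) (h : r ≤ n) : Prop :=
  ∃ U : Matrix (Fin (n - r)) (Fin (n - r)) ℝ, U.PosDef ∧ ∀ i, ip (A i) (padLow r h U) = 0

/-- "Good condition 2": every linear combination of the `Aᵢ` with zero lower-right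
block has zero upper-right block. -/
def GoodCond2 {n m : ℕ} (A : Fin m → Matrix (Fin n) (Fin n) ℝ) (r : ℕ) (h : r ≤ n) : Prop :=
  ∀ lam : Fin m → ℝ, block22 r h (∑ i, lam i • A i) = 0 →
    block12 r h (∑ i, lam i • A i) = 0

/-- `Tmat r h N = [[I_r, 0], [0, N]]`. -/
def Tmat {n : ℕ} (r : ℕ) (h : r ≤ n) (N : Matrix (Fin (n - r)) (Fin (n - r)) ℝ) :
    Matrix (Fin n) (Fin n) ℝ :=
  Matrix.of fun a b =>
    if (a : ℕ) < r ∧ (b : ℕ) < r then (if a = b then (1 : ℝ) else 0)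
    else if hab : r ≤ (a : ℕ) ∧ r ≤ (b : ℕ) then N ⟨a.1 - r, by omega⟩ ⟨b.1 - r, by omega⟩
    else 0

/-- The system `∑ xᵢ A'ᵢ ⪯ B'` is an elementary reformulation of `∑ xᵢ Aᵢ ⪯ B`:
there are an invertible `M : ℝ^{m×m}`, a vector `μ ∈ ℝ^m` and an invertible
`T = [[I_r, 0], [0, N]]` with `A'ᵢ = Tᵀ (∑ⱼ Mᵢⱼ Aⱼ) T` and `B' = Tᵀ (B + ∑ⱼ μⱼ Aⱼ) T`. -/
def ElemReform {n m : ℕ} (r : ℕ) (h : r ≤ n)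
    (A : Fin m → Matrix (Fin n) (Fin n) ℝ) (B : Matrix (Fin n) (Fin n) ℝ)
    (A' : Fin m → Matrix (Fin n) (Fin n) ℝ) (B' : Matrix (Fin n) (Fin n) ℝ) : Prop :=
  ∃ (M : Matrix (Fin m) (Fin m) ℝ) (μ : Fin m → ℝ)
    (N : Matrix (Fin (n - r)) (Fin (n - r)) ℝ),
    IsUnit M ∧ IsUnit (Tmat r h N) ∧
    (∀ i, A' i = (Tmat r h N)ᵀ * (∑ j, M i j • A j) * Tmat r h N) ∧
    B' = (Tmat r h N)ᵀ * (B + ∑ j, μ j • A j) * Tmat r h N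

/-- The last `n - r` columns of a square matrix, as an `n × (n-r)` matrix. -/
def lastCols {n : ℕ} (r : ℕ) (h : r ≤ n) (V : Matrix (Fin n) (Fin n) ℝ) :
    Matrix (Fin n) (Fin (n - r)) ℝ :=
  Matrix.of fun a j => V a ⟨r + j.1, by omega⟩

/-- Bad normal form of a semidefinite system. -/
def BadNormalForm {n m : ℕ} (A : Fin m → Matrix (Fin n) (Fin n) ℝ)
    (B : Matrix (Fin n) (Fin n) ℝ) (r : ℕ) (h : r ≤ n) : Prop :=
  B = Zmat n r ∧ MaxRankSlack A B r ∧
  ∃ k : ℕ, ∃ hk : k < m,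
    (∀ i : Fin m, (i : ℕ) < k → ∀ a b : Fin n, r ≤ (b : ℕ) → A i a b = 0) ∧
    (∀ i : Fin m, (i : ℕ) < k → ∀ a b : Fin n, r ≤ (a : ℕ) → A i a b = 0) ∧
    LinearIndependent ℝ (fun i : Fin (m - k) => lastCols r h (A ⟨k + i.1, by omega⟩)) ∧
    (block22 r h (A ⟨m - 1, by omega⟩)).PosSemidef

/-- Good normal form of a semidefinite system. -/
def GoodNormalForm {n m : ℕ} (A : Fin m → Matrix (Fin n) (Fin n) ℝ)
    (B : Matrix (Fin n) (Fin n) ℝ) (r : ℕ) (h : r ≤ n) : Prop :=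
  B = Zmat n r ∧ MaxRankSlack A B r ∧
  ∃ k : ℕ, ∃ _hk : k ≤ m,
    (∀ i : Fin m, (i : ℕ) < k → ∀ a b : Fin n,
        (r ≤ (a : ℕ) ∨ r ≤ (b : ℕ)) → A i a b = 0) ∧
    LinearIndependent ℝ (fun i : Fin (m - k) => block22 r h (A ⟨k + i.1, by omega⟩)) ∧
    ∃ U : Matrix (Fin (n - r)) (Fin (n - r)) ℝ, U.PosDef ∧
      ∀ i : Fin m, k ≤ (i : ℕ) → ip (block22 r h (A i)) U = 0

/-- The image of the positive semidefinite cone under `Y ↦ (A₁ • Y, …, A_m • Y)`. -/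
def imageSet {n m : ℕ} (A : Fin m → Matrix (Fin n) (Fin n) ℝ) : Set (Fin m → ℝ) :=
  {y | ∃ Y : Matrix (Fin n) (Fin n) ℝ, Y.PosSemidef ∧ ∀ i, ip (A i) Y = y i}

namespace Matrix

section PosSemidef

variable {α : Type*} [Fintype α]

section Factorization

open scoped ComplexOrder MatrixOrder

lemma PosSemidef.exists_eq_transpose_mul_self {S : Matrix α α ℝ} (hS : S.PosSemidef) :
    ∃ B : Matrix α α ℝ, S = Bᵀ * B := by
  classical
  obtain ⟨B, rfl⟩ := CStarAlgebra.nonneg_iff_eq_star_mul_self.mp hS.nonneg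
  exact ⟨B, by simp [star_eq_conjTranspose]⟩

lemma PosSemidef.mulVec_eq_zero {S : Matrix α α ℝ} (hS : S.PosSemidef) {x : α → ℝ}
    (hx : x ⬝ᵥ (S *ᵥ x) = 0) : S *ᵥ x = 0 :=
  (hS.dotProduct_mulVec_zero_iff x).1 (by simpa using hx)

lemma PosSemidef.eq_zero_of_trace_eq_zero {S : Matrix α α ℝ} (hS : S.PosSemidef)
    (h : S.trace = 0) : S = 0 :=
  hS.trace_eq_zero_iff.1 h

end Factorization

lemma PosSemidef.trace_mul_nonneg {S T : Matrix α α ℝ} (hS : S.PosSemidef) (hT : T.PosSemidef) :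
    0 ≤ (S * T).trace := by
  obtain ⟨B, rfl⟩ := hS.exists_eq_transpose_mul_self
  rw [Matrix.mul_assoc, trace_mul_comm]
  simpa using (hT.mul_mul_conjTranspose_same B).trace_nonneg

lemma PosDef.eq_zero_of_trace_mul_eq_zero {U P : Matrix α α ℝ} (hU : U.PosDef)
    (hP : P.PosSemidef) (h : (U * P).trace = 0) : P = 0 := by
  classical
  obtain ⟨B, rfl⟩ := hU.posSemidef.exists_eq_transpose_mul_self
  have hB : IsUnit B := isUnit_of_mul_isUnit_right hU.isUnit
  rw [Matrix.mul_assoc, trace_mul_comm] at h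
  have h0 := (hP.mul_mul_conjTranspose_same B).eq_zero_of_trace_eq_zero (by simpa using h)
  have hBt : IsUnit Bᴴ := hB.star
  exact hB.mul_right_eq_zero.1 (hBt.mul_left_eq_zero.1 h0)

lemma PosSemidef.of_trace_mul_nonneg {S : Matrix α α ℝ} (hS : S.IsHermitian)
    (h : ∀ P : Matrix α α ℝ, P.PosSemidef → 0 ≤ (S * P).trace) : S.PosSemidef := by
  refine .of_dotProduct_mulVec_nonneg hS fun x => ?_
  have := h (vecMulVec x (star x)) (posSemidef_vecMulVec_self_star x)
  rwa [mul_vecMulVec, trace_vecMulVec, dotProduct_comm] at this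

lemma PosSemidef.apply_eq_zero {S : Matrix α α ℝ} (hS : S.PosSemidef) {i : α}
    (hi : S i i = 0) (j : α) : S j i = 0 := by
  classical
  have := congrFun (hS.mulVec_eq_zero (x := Pi.single i 1) (by simpa using hi)) j
  simpa using this

lemma PosSemidef.abs_apply_le_trace {S : Matrix α α ℝ} (hS : S.PosSemidef) (i j : α) :
    |S i j| ≤ S.trace := by
  classical
  have hii : ∀ k, S k k ≤ S.trace := fun k =>
    Finset.single_le_sum (f := fun k => S k k) (fun k _ => hS.diag_nonneg) (Finset.mem_univ k)
  have hsymm : S j i = S i j := by simpa using hS.isHermitian.apply i j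
  have h1 := hS.dotProduct_mulVec_nonneg (Pi.single i 1 + Pi.single j 1)
  have h2 := hS.dotProduct_mulVec_nonneg (Pi.single i 1 - Pi.single j 1)
  simp [mulVec_add, mulVec_sub, add_dotProduct, sub_dotProduct, hsymm] at h1 h2
  rw [abs_le]
  constructor <;> linarith [hii i, hii j]

lemma isClosed_setOf_posSemidef : IsClosed {P : Matrix α α ℝ | P.PosSemidef} := by
  simp only [posSemidef_iff_dotProduct_mulVec, Set.ofPred_and, Set.ofPred_forall, IsHermitian]
  exact (isClosed_eq (by fun_prop) (by fun_prop)).inter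
    (isClosed_iInter fun x => isClosed_le (by fun_prop) (by fun_prop))

section Norm

open scoped Matrix.Norms.Elementwise

lemma isCompact_setOf_posSemidef_trace_le (c : ℝ) :
    IsCompact {P : Matrix α α ℝ | P.PosSemidef ∧ P.trace ≤ c} := by
  refine Metric.isCompact_of_isClosed_isBounded
    (isClosed_setOf_posSemidef.inter (isClosed_le continuous_id.matrix_trace continuous_const)) ?_
  refine (Metric.isBounded_closedBall (x := 0) (r := c)).subset fun P hP => ?_
  have hc : 0 ≤ c := hP.1.trace_nonneg.trans hP.2
  rw [mem_closedBall_zero_iff, norm_le_iff hc]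
  exact fun i j => (hP.1.abs_apply_le_trace i j).trans hP.2

lemma isCompact_setOf_posSemidef_trace_eq_one :
    IsCompact {P : Matrix α α ℝ | P.PosSemidef ∧ P.trace = 1} :=
  (isCompact_setOf_posSemidef_trace_le 1).of_isClosed_subset
    (isClosed_setOf_posSemidef.inter (isClosed_eq continuous_id.matrix_trace continuous_const))
    fun _ h => ⟨h.1, h.2.le⟩

lemma PosSemidef.exists_smul_trace_eq_one {P : Matrix α α ℝ} (hP : P.PosSemidef) (h : P ≠ 0) :
    ∃ c : ℝ, 0 < c ∧ (c • P).PosSemidef ∧ (c • P).trace = 1 := by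
  have ht : 0 < P.trace :=
    lt_of_le_of_ne hP.trace_nonneg fun h0 => h (hP.eq_zero_of_trace_eq_zero h0.symm)
  exact ⟨P.trace⁻¹, inv_pos.2 ht, hP.smul (inv_pos.2 ht).le, by
    rw [trace_smul, smul_eq_mul, inv_mul_cancel₀ ht.ne']⟩

/-- A symmetric matrix becomes positive semidefinite after adding a large multiple of a
positive definite one. -/
lemma PosDef.exists_add_smul_posSemidef {U S : Matrix α α ℝ} (hU : U.PosDef)
    (hS : S.IsHermitian) : ∃ t : ℝ, (S + t • U).PosSemidef := by
  have hpos : ∀ P : Matrix α α ℝ, P.PosSemidef ∧ P.trace = 1 → 0 < (U * P).trace := by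
    rintro P ⟨hP, h1⟩
    refine lt_of_le_of_ne (hU.posSemidef.trace_mul_nonneg hP) fun h0 => ?_
    simp [hU.eq_zero_of_trace_mul_eq_zero hP h0.symm] at h1
  obtain ⟨t, ht⟩ := isCompact_setOf_posSemidef_trace_eq_one.bddAbove_image
    (f := fun P : Matrix α α ℝ => -(S * P).trace / (U * P).trace)
    (ContinuousOn.div (by fun_prop) (by fun_prop) fun P hP => (hpos P hP).ne')
  refine ⟨t, .of_trace_mul_nonneg (hS.add (hU.isHermitian.smul (IsSelfAdjoint.all t)))
    fun P hP => ?_⟩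
  by_cases h0 : P = 0
  · simp [h0]
  obtain ⟨c, hc, hcP⟩ := hP.exists_smul_trace_eq_one h0
  have h2 : -(S * (c • P)).trace / (U * (c • P)).trace ≤ t := ht ⟨_, hcP, rfl⟩
  rw [div_le_iff₀ (hpos _ hcP)] at h2
  simp only [Matrix.mul_smul, trace_smul, smul_eq_mul] at h2
  have h3 : 0 ≤ c * ((S * P).trace + t * (U * P).trace) := by linarith
  simpa [Matrix.add_mul] using nonneg_of_mul_nonneg_right h3 hc

/-- Stiemke's lemma for the positive semidefinite cone. -/
lemma exists_posDef_forall_trace_mul_eq_zero {E : Type*} [AddCommGroup E] [Module ℝ E]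
    (B : E →ₗ[ℝ] Matrix α α ℝ) (hB : ∀ x, (B x).PosSemidef → B x = 0) :
    ∃ U : Matrix α α ℝ, U.PosDef ∧ ∀ x, (B x).IsHermitian → (U * B x).trace = 0 := by
  classical
  have : LocallyConvexSpace ℝ (Matrix α α ℝ) :=
    inferInstanceAs (LocallyConvexSpace ℝ (α → α → ℝ))
  obtain ⟨f, u, v, hu, huv, hv⟩ := geometric_hahn_banach_compact_closed
    (s := {P : Matrix α α ℝ | P.PosSemidef ∧ P.trace = 1}) (t := (LinearMap.range B : Set _))
    (by
      rintro P ⟨hP, hP1⟩ Q ⟨hQ, hQ1⟩ a b ha hb hab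
      exact ⟨(hP.smul ha).add (hQ.smul hb), by simp [hP1, hQ1, hab]⟩)
    isCompact_setOf_posSemidef_trace_eq_one (LinearMap.range B).convex
    (Submodule.closed_of_finiteDimensional _)
    (Set.disjoint_left.2 (by
      rintro _ ⟨hP, hP1⟩ ⟨x, rfl⟩
      simp [hB x hP] at hP1))
  have hv0 : v < 0 := by simpa using hv 0 (zero_mem _)
  have hker : ∀ x, f (B x) = 0 := by
    intro x
    by_contra hne
    have := hv ((v / f (B x)) • B x) (by rw [← map_smul]; exact ⟨_, rfl⟩)
    simp [hne] at this
  set U : Matrix α α ℝ := of fun i j => -(f (single i j 1) + f (single j i 1)) / 2 with hUdef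
  have hfU : ∀ P : Matrix α α ℝ, P.IsHermitian → (U * P).trace = -f P := by
    intro P hP
    have hfP : f P = ∑ i, ∑ j, P i j * f (single i j 1) := by
      conv_lhs => rw [matrix_eq_sum_single P]
      simp only [map_sum]
      refine Finset.sum_congr rfl fun i _ => Finset.sum_congr rfl fun j _ => ?_
      rw [← smul_eq_mul, ← map_smul, smul_single, smul_eq_mul, mul_one]
    have hfP' : f P = ∑ i, ∑ j, P i j * f (single j i 1) := by
      rw [hfP, Finset.sum_comm]
      refine Finset.sum_congr rfl fun i _ => Finset.sum_congr rfl fun j _ => ?_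
      rw [← hP.apply j i]; simp
    have : (U * P).trace = -((∑ i, ∑ j, P i j * f (single i j 1)) +
        ∑ i, ∑ j, P i j * f (single j i 1)) / 2 := by
      simp only [trace, diag_apply, mul_apply, hUdef, of_apply, ← Finset.sum_add_distrib,
        ← Finset.sum_neg_distrib, Finset.sum_div]
      refine Finset.sum_congr rfl fun i _ => Finset.sum_congr rfl fun j _ => ?_
      rw [← hP.apply j i]; simp; ring
    rw [this, ← hfP, ← hfP']; ring
  have hpos : ∀ P : Matrix α α ℝ, P.PosSemidef → P ≠ 0 → 0 < (U * P).trace := by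
    intro P hP hP0
    obtain ⟨c, hc, hcP⟩ := hP.exists_smul_trace_eq_one hP0
    have := hu _ hcP
    rw [map_smul, smul_eq_mul] at this
    rw [hfU P hP.isHermitian]
    exact pos_of_mul_pos_right (by linarith : 0 < c * -f P) hc.le
  refine ⟨U, ?_, fun x hx => by rw [hfU _ hx, hker, neg_zero]⟩
  refine .of_dotProduct_mulVec_pos ?_ fun x hx => ?_
  · ext i j
    simp [hUdef, add_comm]
  · have := hpos (vecMulVec x (star x)) (posSemidef_vecMulVec_self_star x)
      (by simpa [vecMulVec_eq_zero] using hx)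
    rwa [mul_vecMulVec, trace_vecMulVec, dotProduct_comm] at this

end Norm

lemma PosSemidef.fromBlocks_zero {β : Type*} [Fintype β] {P : Matrix α α ℝ} {Q : Matrix β β ℝ}
    (hP : P.PosSemidef) (hQ : Q.PosSemidef) : (fromBlocks P 0 0 Q).PosSemidef := by
  refine .of_dotProduct_mulVec_nonneg (hP.isHermitian.fromBlocks (by simp) hQ.isHermitian)
    fun x => ?_
  have h1 := hP.dotProduct_mulVec_nonneg (x ∘ Sum.inl)
  have h2 := hQ.dotProduct_mulVec_nonneg (x ∘ Sum.inr)
  simp only [fromBlocks_mulVec, zero_mulVec, add_zero, zero_add, dotProduct, Fintype.sum_sum_type]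
  exact add_nonneg h1 h2

end PosSemidef

section ConeImage

lemma IsHermitian.toBlocks₂₁_eq {p q : Type*} {V : Matrix (p ⊕ q) (p ⊕ q) ℝ} (hV : V.IsHermitian) :
    V.toBlocks₂₁ = V.toBlocks₁₂ᵀ := by
  ext i j
  exact (hV.apply (Sum.inr i) (Sum.inl j)).symm

lemma IsHermitian.toBlocks₂₂ {p q : Type*} {V : Matrix (p ⊕ q) (p ⊕ q) ℝ} (hV : V.IsHermitian) :
    V.toBlocks₂₂.IsHermitian :=
  hV.submatrix Sum.inr

variable {p q ι : Type*} [Fintype p] [Fintype q] [Fintype ι]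
  {L : (ι → ℝ) →ₗ[ℝ] Matrix (p ⊕ q) (p ⊕ q) ℝ} {D : Matrix (p ⊕ q) (p ⊕ q) ℝ →ₗ[ℝ] ι → ℝ}

lemma trace_mul_fromBlocks (V : Matrix (p ⊕ q) (p ⊕ q) ℝ) (P : Matrix p p ℝ) (Q : Matrix p q ℝ)
    (R : Matrix q p ℝ) (S : Matrix q q ℝ) :
    (V * fromBlocks P Q R S).trace =
      (V.toBlocks₁₁ * P).trace + (V.toBlocks₁₂ * R).trace +
        ((V.toBlocks₂₁ * Q).trace + (V.toBlocks₂₂ * S).trace) := by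
  conv_lhs => rw [← fromBlocks_toBlocks V, fromBlocks_multiply]
  simp [trace, Fintype.sum_sum_type, Finset.sum_add_distrib]

/-- If adding `diag(I, 0)` to a positive semidefinite matrix does not raise the rank above the
size of the identity block, then the remaining columns vanish. -/
lemma PosSemidef.apply_inr_eq_zero_of_rank_le [DecidableEq p] {S : Matrix (p ⊕ q) (p ⊕ q) ℝ}
    (hS : S.PosSemidef) (h : (S + fromBlocks 1 0 0 0).rank ≤ Fintype.card p) (i : p ⊕ q) (j : q) :
    S i (Sum.inr j) = 0 := by
  classical
  set Z : Matrix (p ⊕ q) (p ⊕ q) ℝ := fromBlocks 1 0 0 0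
  have hZ : ∀ x : p ⊕ q → ℝ, x ⬝ᵥ (Z *ᵥ x) = ∑ i, x (Sum.inl i) * x (Sum.inl i) := fun x => by
    simp [Z, fromBlocks_mulVec, dotProduct, Fintype.sum_sum_type]
  let R : (p ⊕ q → ℝ) →ₗ[ℝ] p → ℝ := LinearMap.funLeft ℝ ℝ Sum.inl
  have hle : LinearMap.ker (S + Z).mulVecLin ≤ LinearMap.ker R := by
    intro x hx
    rw [LinearMap.mem_ker, mulVecLin_apply, add_mulVec] at hx
    have h0 := congrArg (fun y => x ⬝ᵥ y) hx
    simp only [dotProduct_add, hZ, dotProduct_zero] at h0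
    have h1 : 0 ≤ x ⬝ᵥ (S *ᵥ x) := by simpa using hS.dotProduct_mulVec_nonneg x
    have h2 : ∑ i, x (Sum.inl i) * x (Sum.inl i) = 0 :=
      le_antisymm (by linarith) (Finset.sum_nonneg fun i _ => mul_self_nonneg _)
    rw [Finset.sum_eq_zero_iff_of_nonneg fun i _ => mul_self_nonneg _] at h2
    ext i
    exact mul_self_eq_zero.1 (h2 i (Finset.mem_univ i))
  have hR : Function.Surjective R := LinearMap.funLeft_surjective_of_injective _ _ _
    Sum.inl_injective
  have h1 := LinearMap.finrank_range_add_finrank_ker R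
  have h2 := LinearMap.finrank_range_add_finrank_ker (S + Z).mulVecLin
  rw [LinearMap.range_eq_top.2 hR, finrank_top] at h1
  rw [rank] at h
  simp only [Module.finrank_fintype_fun_eq_card] at h1 h2
  have heq := Submodule.eq_of_le_of_finrank_le hle (by omega)
  have hmem : Pi.single (Sum.inr j) 1 ∈ LinearMap.ker (S + Z).mulVecLin := by
    rw [heq]
    ext i
    simp [R, LinearMap.funLeft_apply]
  have := congrFun (LinearMap.mem_ker.1 hmem) i
  cases i <;> simpa [Z] using this

lemma exists_dotProduct_eq (f : (ι → ℝ) →ₗ[ℝ] ℝ) :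
    ∃ x : ι → ℝ, ∀ y, f y = x ⬝ᵥ y := by
  classical
  refine ⟨fun i => f (Pi.single i 1), fun y => ?_⟩
  rw [LinearMap.pi_apply_eq_sum_univ f y]
  refine Finset.sum_congr rfl fun i _ => ?_
  rw [smul_eq_mul, mul_comm]
  congr 2
  ext j
  simp [Pi.single_apply, eq_comm]

lemma isClosed_image_posSemidef
    [DecidableEq p] (hL : ∀ x, (L x).IsHermitian) (hLD : ∀ x Y, x ⬝ᵥ D Y = (L x * Y).trace)
    (z : ι → ℝ) (hz : L z = fromBlocks 1 0 0 0)
    (hG : ∀ x, (L x).toBlocks₂₂.PosSemidef → (L x).toBlocks₁₂ = 0 ∧ (L x).toBlocks₂₂ = 0) :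
    IsClosed (D '' {Y | Y.PosSemidef}) := by
  let B : (ι → ℝ) →ₗ[ℝ] Matrix q q ℝ :=
    { toFun := fun x => (L x).toBlocks₂₂
      map_add' := fun x y => by rw [map_add]; rfl
      map_smul' := fun c x => by rw [map_smul]; rfl }
  obtain ⟨U, hU, hUB⟩ := exists_posDef_forall_trace_mul_eq_zero B fun x hx => (hG x hx).2
  have hDU : D (fromBlocks 0 0 0 U) = 0 := by
    refine dotProduct_eq_zero _ fun x => ?_
    rw [dotProduct_comm, hLD, trace_mul_fromBlocks]
    simpa [trace_mul_comm _ U] using show (U * (L x).toBlocks₂₂).trace = 0 from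
      hUB x (hL x).toBlocks₂₂
  let E : Matrix q q ℝ →ₗ[ℝ] ι → ℝ := D ∘ₗ
    { toFun := fun S => fromBlocks 0 0 0 (S + Sᵀ)
      map_add' := fun S T => by simp [fromBlocks_add, add_add_add_comm]
      map_smul' := fun c S => by simp [fromBlocks_smul] }
  have hE : ∀ S, E S = D (fromBlocks 0 0 0 (S + Sᵀ)) := fun _ => rfl
  have hW : ∀ (Q : Matrix p q ℝ) R S, D (fromBlocks 0 Q R S) ∈ LinearMap.range E := by
    intro Q R S
    by_contra hne
    obtain ⟨f, hf, hfE⟩ := Submodule.exists_le_ker_of_notMem hne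
    obtain ⟨x, hx⟩ := exists_dotProduct_eq f
    refine hf ?_
    have h22 : (L x).toBlocks₂₂ = 0 := by
      have h0 : f (E (L x).toBlocks₂₂) = 0 := hfE ⟨_, rfl⟩
      have ht : (L x).toBlocks₂₂ᵀ = (L x).toBlocks₂₂ := by simpa using (hL x).toBlocks₂₂.eq
      rw [hx, hE, hLD, trace_mul_fromBlocks, ht] at h0
      simp only [Matrix.mul_zero, trace_zero, zero_add, Matrix.mul_add, trace_add] at h0
      refine trace_conjTranspose_mul_self_eq_zero_iff.1 ?_
      rw [(hL x).toBlocks₂₂.eq]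
      linarith
    have h12 := (hG x (h22 ▸ .zero)).1
    rw [hx, hLD, trace_mul_fromBlocks, h22, (hL x).toBlocks₂₁_eq, h12]
    simp
  have hmem : ∀ y, y ∈ D '' {Y | Y.PosSemidef} ↔ ∃ X : Matrix p p ℝ, X.PosSemidef ∧
      X.trace = z ⬝ᵥ y ∧ y - D (fromBlocks X 0 0 0) ∈ LinearMap.range E := by
    intro y
    constructor
    · rintro ⟨Y, hY, rfl⟩
      refine ⟨Y.toBlocks₁₁, hY.submatrix Sum.inl, ?_, ?_⟩
      · rw [hLD, hz, ← fromBlocks_toBlocks Y, trace_mul_fromBlocks]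
        simp
      · rw [← map_sub]
        convert hW Y.toBlocks₁₂ Y.toBlocks₂₁ Y.toBlocks₂₂ using 2
        conv_lhs => rw [← fromBlocks_toBlocks Y]
        simp [sub_eq_add_neg, fromBlocks_neg, fromBlocks_add]
    · rintro ⟨X, hX, -, S, hS⟩
      obtain ⟨t, ht⟩ := hU.exists_add_smul_posSemidef
        (S := S + Sᵀ) (by simpa using isHermitian_add_transpose_self S)
      refine ⟨_, hX.fromBlocks_zero ht, ?_⟩
      have : fromBlocks X 0 0 (S + Sᵀ + t • U) =
          fromBlocks X 0 0 0 + fromBlocks 0 0 0 (S + Sᵀ) + t • fromBlocks 0 0 0 U := by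
        simp [fromBlocks_add, fromBlocks_smul]
      rw [this, map_add, map_add, map_smul, hDU, ← hE, hS]
      simp
  refine IsSeqClosed.isClosed fun y y₀ hy hy₀ => ?_
  choose X hX using fun k => (hmem (y k)).1 (hy k)
  have hzy : Continuous fun y : ι → ℝ => z ⬝ᵥ y := by fun_prop
  have htr := (hzy.tendsto y₀).comp hy₀
  obtain ⟨c, hc⟩ := htr.bddAbove_range
  have : FirstCountableTopology (Matrix p p ℝ) :=
    inferInstanceAs (FirstCountableTopology (p → p → ℝ))
  obtain ⟨X₀, hX₀, φ, hφ, hlim⟩ := (isCompact_setOf_posSemidef_trace_le c).tendsto_subseq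
    (x := X) fun k => ⟨(hX k).1, (hX k).2.1 ▸ hc ⟨k, rfl⟩⟩
  refine (hmem y₀).2 ⟨X₀, hX₀.1, ?_, ?_⟩
  · refine tendsto_nhds_unique (((continuous_id.matrix_trace).tendsto X₀).comp hlim)
      ((htr.comp hφ.tendsto_atTop).congr fun k => ((hX (φ k)).2.1).symm)
  · refine (Submodule.closed_of_finiteDimensional (LinearMap.range E)).mem_of_tendsto
      ((hy₀.comp hφ.tendsto_atTop).sub (((?_ : Continuous fun X => D (fromBlocks X 0 0 0)).tendsto
        X₀).comp hlim)) (.of_forall fun k => (hX (φ k)).2.2)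
    have hD : Continuous D := D.continuous_of_finiteDimensional
    exact hD.comp (by fun_prop)

lemma toBlocks_eq_zero_of_isClosed_image_posSemidef
    [DecidableEq p] (hL : ∀ x, (L x).IsHermitian) (hLD : ∀ x Y, x ⬝ᵥ D Y = (L x * Y).trace)
    (z : ι → ℝ) (hz : L z = fromBlocks 1 0 0 0)
    (hmax : ∀ x, (L x).PosSemidef → (L x).rank ≤ Fintype.card p)
    (hcl : IsClosed (D '' {Y | Y.PosSemidef})) (x : ι → ℝ) (hx : (L x).toBlocks₂₂.PosSemidef) :
    (L x).toBlocks₁₂ = 0 ∧ (L x).toBlocks₂₂ = 0 := by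
  have hslack : ∀ w, (L w).PosSemidef → ∀ i j, L w i (Sum.inr j) = 0 := by
    intro w hw
    refine hw.apply_inr_eq_zero_of_rank_le ?_
    rw [← hz, ← map_add]
    refine hmax _ ?_
    rw [map_add, hz]
    exact hw.add (PosSemidef.one.fromBlocks_zero .zero)
  have h12 : (L x).toBlocks₁₂ = 0 := by
    set V := (L x).toBlocks₁₂ with hV
    set Y₀ : Matrix (p ⊕ q) (p ⊕ q) ℝ := fromBlocks 0 (-V) (-Vᵀ) 0
    have hmem : D Y₀ ∈ D '' {Y | Y.PosSemidef} := by
      by_contra hne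
      obtain ⟨f, u, hf, hu⟩ := geometric_hahn_banach_closed_point
        (Convex.linear_image (fun P hP Q hQ a b ha hb _ => (hP.smul ha).add (hQ.smul hb)) D)
        hcl hne
      obtain ⟨w, hw⟩ := exists_dotProduct_eq f.toLinearMap
      have hf0 : 0 < u := by simpa using hf 0 ⟨0, .zero, map_zero D⟩
      have hle : ∀ P : Matrix (p ⊕ q) (p ⊕ q) ℝ, P.PosSemidef → f (D P) ≤ 0 := by
        intro P hP
        by_contra! hpos
        have := hf (D ((u / f (D P)) • P)) ⟨_, hP.smul (by positivity), rfl⟩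
        simp [hpos.ne'] at this
      have hfw : ∀ P, f (D P) = (L w * P).trace := fun P => (hw (D P)).trans (hLD w P)
      have hps : (L (-w)).PosSemidef := .of_trace_mul_nonneg (hL _) fun P hP => by
        have := hle P hP
        rw [hfw] at this
        simpa using this
      have h12w : (L w).toBlocks₁₂ = 0 := by
        ext i j
        simpa [toBlocks₁₂] using hslack _ hps (Sum.inl i) j
      have : f (D Y₀) = 0 := by
        rw [hfw, trace_mul_fromBlocks, (hL w).toBlocks₂₁_eq, h12w]
        simp
      linarith
    obtain ⟨Y, hY, hYD⟩ := hmem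
    have hY11 : Y.toBlocks₁₁ = 0 := by
      refine PosSemidef.eq_zero_of_trace_eq_zero (hY.submatrix Sum.inl) ?_
      have h1 := (hLD z Y).symm.trans ((congrArg (fun y => z ⬝ᵥ y) hYD).trans (hLD z Y₀))
      rw [hz, ← fromBlocks_toBlocks Y, trace_mul_fromBlocks, trace_mul_fromBlocks] at h1
      simpa using h1
    have hY21 : Y.toBlocks₂₁ = 0 := by
      ext i j
      exact hY.apply_eq_zero (congrFun (congrFun hY11 j) j) _
    have hY12 : Y.toBlocks₁₂ = 0 := by
      have := hY.isHermitian.toBlocks₂₁_eq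
      rwa [hY21, eq_comm, transpose_eq_zero] at this
    have h1 := (hLD x Y).symm.trans ((congrArg (fun y => x ⬝ᵥ y) hYD).trans (hLD x Y₀))
    rw [← fromBlocks_toBlocks Y, trace_mul_fromBlocks, trace_mul_fromBlocks, hY11, hY12, hY21,
      (hL x).toBlocks₂₁_eq, ← hV] at h1
    have h2 : 0 ≤ ((L x).toBlocks₂₂ * Y.toBlocks₂₂).trace :=
      hx.trace_mul_nonneg (hY.submatrix Sum.inr)
    have h3 : 0 ≤ (V * Vᵀ).trace := by simpa using (posSemidef_self_mul_conjTranspose V).trace_nonneg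
    rw [← trace_mul_conjTranspose_self_eq_zero_iff]
    simp [trace_mul_comm Vᵀ V] at h1 ⊢
    linarith
  refine ⟨h12, ?_⟩
  obtain ⟨t, ht⟩ := (PosDef.one : (1 : Matrix p p ℝ).PosDef).exists_add_smul_posSemidef
    (S := (L x).toBlocks₁₁) ((hL x).submatrix Sum.inl)
  have heq : L (x + t • z) = fromBlocks ((L x).toBlocks₁₁ + t • 1) 0 0 (L x).toBlocks₂₂ := by
    rw [map_add, map_smul, hz]
    conv_lhs => rw [← fromBlocks_toBlocks (L x), (hL x).toBlocks₂₁_eq, h12]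
    simp [fromBlocks_add, fromBlocks_smul]
  ext i j
  have := hslack _ (heq ▸ ht.fromBlocks_zero hx) (Sum.inr i) j
  simpa [heq] using this

end ConeImage

end Matrix

lemma exists_basis_extending {E F : Type*} [AddCommGroup E] [Module ℝ E] [FiniteDimensional ℝ E]
    [AddCommGroup F] [Module ℝ F] (f : E →ₗ[ℝ] F) {v : E} (hv : f v ≠ 0)
    {d : ℕ} (hd : Module.finrank ℝ (LinearMap.range f) = d) :
    ∃ (b : Fin d → E) (j₀ : Fin d), LinearIndependent ℝ (fun j => f (b j)) ∧
      (j₀ : ℕ) = d - 1 ∧ b j₀ = v := by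
  subst hd
  set R := LinearMap.range f
  let w : R := ⟨f v, v, rfl⟩
  have hw : w ≠ 0 := fun h => hv (congrArg Subtype.val h)
  let B := Module.Basis.extend (LinearIndepOn.singleton (R := ℝ) (v := id) hw)
  have : Fintype _ := FiniteDimensional.fintypeBasisIndex B
  have hcard := Module.finrank_eq_card_basis B
  let i₀ : (LinearIndepOn.singleton (R := ℝ) (v := id) hw).extend (Set.subset_univ {w}) :=
    ⟨w, Module.Basis.subset_extend _ rfl⟩
  have hpos : 0 < Module.finrank ℝ R := hcard ▸ Fintype.card_pos_iff.2 ⟨i₀⟩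
  let j₀ : Fin (Module.finrank ℝ R) := ⟨Module.finrank ℝ R - 1, by omega⟩
  let e := (Fintype.equivFinOfCardEq hcard.symm).symm
  let e' := (Equiv.swap j₀ (e.symm i₀)).trans e
  have he' : e' j₀ = i₀ := by simp [e']
  have hB : ∀ j, ∃ x : E, f x = (B (e' j) : R) ∧ (j = j₀ → x = v) := by
    intro j
    by_cases hj : j = j₀
    · exact ⟨v, by rw [hj, he', Module.Basis.extend_apply_self], fun _ => rfl⟩
    · obtain ⟨x, hx⟩ := (B (e' j)).2
      exact ⟨x, hx, fun h => absurd h hj⟩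
  choose b hb hbv using hB
  refine ⟨b, j₀, ?_, rfl, hbv j₀ rfl⟩
  simp only [hb]
  exact (B.linearIndependent.comp e' e'.injective).map' R.subtype (Submodule.ker_subtype R)

/-- The order preserving identification of `Fin r ⊕ Fin (n - r)` with `Fin n`. -/
def splitEquiv {n r : ℕ} (h : r ≤ n) : Fin r ⊕ Fin (n - r) ≃ Fin n :=
  finSumFinEquiv.trans (finCongr (by omega))

@[simp] lemma splitEquiv_inl {n r : ℕ} (h : r ≤ n) (i : Fin r) :
    splitEquiv h (Sum.inl i) = ⟨i, by omega⟩ := rfl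

@[simp] lemma splitEquiv_inr {n r : ℕ} (h : r ≤ n) (i : Fin (n - r)) :
    splitEquiv h (Sum.inr i) = ⟨r + i, by omega⟩ := rfl

/-- Change of basis adapted to the kernel of `f`, with a prescribed last vector. -/
lemma exists_isUnit_adapted {m : ℕ} {F : Type*} [AddCommGroup F] [Module ℝ F]
    (f : (Fin m → ℝ) →ₗ[ℝ] F) {v : Fin m → ℝ} (hv : f v ≠ 0) :
    ∃ (M : Matrix (Fin m) (Fin m) ℝ) (k : ℕ) (hk : k < m), IsUnit M ∧
      (∀ i : Fin m, (i : ℕ) < k → f (M i) = 0) ∧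
      LinearIndependent ℝ (fun i : Fin (m - k) => f (M ⟨k + i.1, by omega⟩)) ∧
      M ⟨m - 1, by omega⟩ = v := by
  set k := Module.finrank ℝ (LinearMap.ker f) with hk
  have hrank := LinearMap.finrank_range_add_finrank_ker f
  rw [Module.finrank_fin_fun, ← hk] at hrank
  obtain ⟨b, j₀, hb, hj₀, hbv⟩ := exists_basis_extending f hv (d := m - k) (by omega)
  have hkm : k < m := by have := j₀.2; omega
  have hker : ∀ c : Fin k → ℝ, ∑ i, c i • f (Module.finBasis ℝ (LinearMap.ker f) i) = 0 :=
    fun c => Finset.sum_eq_zero fun i _ => by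
      rw [LinearMap.mem_ker.1 (Module.finBasis ℝ (LinearMap.ker f) i).2, smul_zero]
  let g : Fin k ⊕ Fin (m - k) → Fin m → ℝ :=
    Sum.elim (fun i => (Module.finBasis ℝ (LinearMap.ker f) i : Fin m → ℝ)) b
  have hg : LinearIndependent ℝ g := by
    rw [Fintype.linearIndependent_iff]
    intro c hc
    rw [Fintype.sum_sum_type] at hc
    have hinr : ∀ j, c (Sum.inr j) = 0 := by
      refine Fintype.linearIndependent_iff.1 hb _ ?_
      have := congrArg f hc
      simpa [g, hker] using this
    have hinl : ∀ j, c (Sum.inl j) = 0 := by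
      refine Fintype.linearIndependent_iff.1
        ((Module.finBasis ℝ (LinearMap.ker f)).linearIndependent.map' _
          (Submodule.ker_subtype _)) _ ?_
      simpa [g, hinr] using hc
    rintro (j | j)
    exacts [hinl j, hinr j]
  let M : Matrix (Fin m) (Fin m) ℝ := of fun i => g ((splitEquiv hkm.le).symm i)
  have hinr : ∀ i : Fin (m - k), M ⟨k + i, by omega⟩ = b i := fun i =>
    show g ((splitEquiv hkm.le).symm (splitEquiv hkm.le (Sum.inr i))) = b i by
      rw [Equiv.symm_apply_apply]; rfl
  refine ⟨M, k, hkm, ?_, fun i hi => ?_, ?_, ?_⟩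
  · rw [← linearIndependent_rows_iff_isUnit]
    exact hg.comp _ (splitEquiv hkm.le).symm.injective
  · have : M i = g (Sum.inl ⟨i, hi⟩) :=
      show g ((splitEquiv hkm.le).symm (splitEquiv hkm.le (Sum.inl ⟨i, hi⟩))) = _ by
        rw [Equiv.symm_apply_apply]
    rw [this]
    exact (Module.finBasis ℝ (LinearMap.ker f) ⟨i, hi⟩).2
  · simpa only [hinr] using hb
  · rw [← hbv, ← hinr]
    congr 2
    omega

section Blocks

variable {n r : ℕ} (h : r ≤ n)

lemma lastCols_mul (X Y : Matrix (Fin n) (Fin n) ℝ) :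
    lastCols r h (X * Y) = X * lastCols r h Y := rfl

lemma Tmat_one : Tmat r h (1 : Matrix (Fin (n - r)) (Fin (n - r)) ℝ) = 1 := by
  ext a b
  simp only [Tmat, of_apply, one_apply, Fin.ext_iff]
  split_ifs <;> first | rfl | omega

lemma lastCols_mul_Tmat (X : Matrix (Fin n) (Fin n) ℝ)
    (N : Matrix (Fin (n - r)) (Fin (n - r)) ℝ) :
    lastCols r h (X * Tmat r h N) = lastCols r h X * N := by
  ext a j
  simp only [lastCols, of_apply, mul_apply]
  rw [← (splitEquiv h).sum_comp, Fintype.sum_sum_type, Finset.sum_eq_zero fun i _ => ?_]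
  · simp [Tmat]
  · have := i.2
    simp [Tmat, this.not_ge]

lemma block22_mul_Tmat (X : Matrix (Fin n) (Fin n) ℝ)
    (N : Matrix (Fin (n - r)) (Fin (n - r)) ℝ) :
    block22 r h (X * Tmat r h N) = block22 r h X * N := by
  ext i j
  exact congrFun (congrFun (lastCols_mul_Tmat h X N) ⟨r + i, by omega⟩) j

lemma block22_transpose_mul_mul_Tmat (X : Matrix (Fin n) (Fin n) ℝ)
    (N : Matrix (Fin (n - r)) (Fin (n - r)) ℝ) :
    block22 r h ((Tmat r h N)ᵀ * X * Tmat r h N) = Nᵀ * block22 r h X * N := by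
  have : block22 r h ((Tmat r h N)ᵀ * X) = (block22 r h (Xᵀ * Tmat r h N))ᵀ := by
    rw [← transpose_transpose ((Tmat r h N)ᵀ * X), transpose_mul, transpose_transpose]
    rfl
  rw [block22_mul_Tmat, this, block22_mul_Tmat, transpose_mul]
  rfl

lemma isUnit_of_isUnit_Tmat {N : Matrix (Fin (n - r)) (Fin (n - r)) ℝ}
    (hT : IsUnit (Tmat r h N)) : IsUnit N := by
  obtain ⟨S, hS⟩ := hT.exists_left_inv
  have h1 := congrArg (block22 r h) hS
  rw [block22_mul_Tmat] at h1
  have h2 : block22 r h (1 : Matrix (Fin n) (Fin n) ℝ) = 1 := by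
    ext i j
    simp [block22, one_apply, Fin.ext_iff]
  exact isUnit_of_mul_isUnit_right (h1.trans h2 ▸ isUnit_one)

lemma lastCols_eq_zero_of_transpose_mul_mul_Tmat {X : Matrix (Fin n) (Fin n) ℝ}
    {N : Matrix (Fin (n - r)) (Fin (n - r)) ℝ} (hT : IsUnit (Tmat r h N))
    (h0 : lastCols r h ((Tmat r h N)ᵀ * X * Tmat r h N) = 0) : lastCols r h X = 0 := by
  obtain ⟨S, hS⟩ := hT.exists_left_inv
  obtain ⟨N', hN'⟩ := (isUnit_of_isUnit_Tmat h hT).exists_right_inv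
  rw [lastCols_mul_Tmat, lastCols_mul] at h0
  have hS' : Sᵀ * (Tmat r h N)ᵀ = 1 := by
    rw [← transpose_mul, mul_eq_one_comm.1 hS, transpose_one]
  calc lastCols r h X
      = Sᵀ * (Tmat r h N)ᵀ * lastCols r h X * (N * N') := by
        rw [hS', hN', Matrix.one_mul, Matrix.mul_one]
    _ = Sᵀ * ((Tmat r h N)ᵀ * lastCols r h X * N) * N' := by simp only [Matrix.mul_assoc]
    _ = 0 := by rw [h0, Matrix.mul_zero, Matrix.zero_mul]

lemma lastCols_eq_zero_iff {X : Matrix (Fin n) (Fin n) ℝ} :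
    lastCols r h X = 0 ↔ ∀ a b : Fin n, r ≤ (b : ℕ) → X a b = 0 := by
  constructor
  · intro h0 a b hb
    have := congrFun (congrFun h0 a) ⟨b - r, by omega⟩
    simpa [lastCols, Nat.add_sub_cancel' hb] using this
  · intro h0
    ext a j
    exact h0 a _ (by simp)

/-- `lastCols` as a linear map. -/
def lastColsLinear : Matrix (Fin n) (Fin n) ℝ →ₗ[ℝ] Matrix (Fin n) (Fin (n - r)) ℝ where
  toFun := lastCols r h
  map_add' _ _ := rfl
  map_smul' _ _ := rfl

/-- `block22` as a linear map. -/
def block22Linear : Matrix (Fin n) (Fin n) ℝ →ₗ[ℝ] Matrix (Fin (n - r)) (Fin (n - r)) ℝ where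
  toFun := block22 r h
  map_add' _ _ := rfl
  map_smul' _ _ := rfl

lemma block22_eq_zero_of_lastCols_eq_zero {X : Matrix (Fin n) (Fin n) ℝ}
    (h0 : lastCols r h X = 0) : block22 r h X = 0 := by
  ext i j
  exact congrFun (congrFun h0 ⟨r + i, by omega⟩) j

end Blocks

section Systems

variable {n m : ℕ} {A : Fin m → Matrix (Fin n) (Fin n) ℝ} {r : ℕ} (hr : r ≤ n)

/-- Every linear combination with positive semidefinite lower-right block is supported on the
upper-left block. -/
def SpanCond {n m : ℕ} (A : Fin m → Matrix (Fin n) (Fin n) ℝ) (r : ℕ) (hr : r ≤ n) : Prop :=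
  ∀ x : Fin m → ℝ, (block22 r hr (∑ i, x i • A i)).PosSemidef →
    lastCols r hr (∑ i, x i • A i) = 0

lemma isSymm_sum_smul (hA : ∀ i, (A i).IsSymm) (x : Fin m → ℝ) : (∑ i, x i • A i).IsSymm := by
  simp only [IsSymm, transpose_sum, transpose_smul, fun i => (hA i).eq]

lemma isClosed_imageSet_iff (hA : ∀ i, (A i).IsSymm) (hZ : MaxRankSlack A 0 r) :
    IsClosed (imageSet A) ↔ SpanCond A r hr := by
  let e := splitEquiv hr
  let L : (Fin m → ℝ) →ₗ[ℝ] Matrix (Fin r ⊕ Fin (n - r)) (Fin r ⊕ Fin (n - r)) ℝ :=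
    (reindexLinearEquiv ℝ ℝ e.symm e.symm).toLinearMap ∘ₗ Fintype.linearCombination ℝ A
  let D : Matrix (Fin r ⊕ Fin (n - r)) (Fin r ⊕ Fin (n - r)) ℝ →ₗ[ℝ] Fin m → ℝ :=
    { toFun := fun Y i => ((A i).submatrix e e * Y).trace
      map_add' := fun X Y => by ext i; simp [Matrix.mul_add]
      map_smul' := fun c X => by ext i; simp }
  have hLapp : ∀ x, L x = (∑ i, x i • A i).submatrix e e := fun x => by
    simp [L, Fintype.linearCombination_apply]
  have hL : ∀ x, (L x).IsHermitian := fun x => by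
    rw [hLapp]
    refine IsHermitian.submatrix ?_ _
    simpa [IsHermitian] using (isSymm_sum_smul hA x).eq
  have hLD : ∀ x Y, x ⬝ᵥ D Y = (L x * Y).trace := by
    intro x Y
    have : (∑ i, x i • A i).submatrix e e = ∑ i, x i • (A i).submatrix e e := by
      ext a b
      simp [Matrix.sum_apply]
    simp [hLapp, this, Finset.sum_mul, trace_sum, dotProduct, D]
  obtain ⟨⟨z, hz⟩, hmax⟩ := hZ
  have hLz : L (-z) = fromBlocks 1 0 0 0 := by
    have : ∑ i, (-z) i • A i = Zmat n r := by simpa using hz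
    rw [hLapp, this]
    ext (a | a) (b | b) <;> (simp [Zmat, e, one_apply, Fin.ext_iff]; try omega)
  have hLmax : ∀ x, (L x).PosSemidef → (L x).rank ≤ Fintype.card (Fin r) := by
    intro x hx
    have hneg : 0 - ∑ i, (-x) i • A i = ∑ i, x i • A i := by simp
    rw [hLapp, posSemidef_submatrix_equiv] at hx
    have := hmax (-x) (by rwa [IsFeasible, hneg])
    rw [hneg] at this
    rwa [hLapp, rank_submatrix, Fintype.card_fin]
  have himage : imageSet A = D '' {Y | Y.PosSemidef} := by
    ext y
    constructor
    · rintro ⟨Y, hY, hy⟩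
      refine ⟨Y.submatrix e e, hY.submatrix e, ?_⟩
      ext i
      rw [← hy]
      simp [D, ip, submatrix_mul_equiv, trace, ← e.sum_comp]
    · rintro ⟨Y, hY, rfl⟩
      refine ⟨Y.submatrix e.symm e.symm, hY.submatrix e.symm, fun i => ?_⟩
      have : Y = (Y.submatrix e.symm e.symm).submatrix e e := by simp
      conv_rhs => rw [this]
      simp [-submatrix_submatrix, D, ip, submatrix_mul_equiv, trace, ← e.sum_comp]
  have h22 : ∀ x, (L x).toBlocks₂₂ = block22 r hr (∑ i, x i • A i) := fun x => by
    rw [hLapp]; rfl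
  have hlast : ∀ x, lastCols r hr (∑ i, x i • A i) = 0 ↔
      (L x).toBlocks₁₂ = 0 ∧ (L x).toBlocks₂₂ = 0 := by
    intro x
    rw [hLapp]
    constructor
    · intro h0
      exact ⟨by ext a b; exact congrFun (congrFun h0 _) b,
        by ext a b; exact congrFun (congrFun h0 _) b⟩
    · rintro ⟨h1, h2⟩
      ext a b
      obtain ⟨a | a, rfl⟩ := e.surjective a
      exacts [congrFun (congrFun h1 a) b, congrFun (congrFun h2 a) b]
  rw [himage]
  simp only [SpanCond, ← h22, hlast]
  exact ⟨toBlocks_eq_zero_of_isClosed_image_posSemidef hL hLD (-z) hLz hLmax,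
    isClosed_image_posSemidef hL hLD (-z) hLz⟩

lemma reformulation_combination {M : Matrix (Fin m) (Fin m) ℝ} (x : Fin m → ℝ) :
    ∑ i, x i • ∑ j, M i j • A j = ∑ j, (x ᵥ* M) j • A j := by
  simp only [Finset.smul_sum, smul_smul, vecMul, dotProduct, Finset.sum_smul]
  exact Finset.sum_comm

/-- Changing the basis of the span produces an elementary reformulation with right-hand side `Z`. -/
lemma MaxRankSlack.exists_elemReform (hZ : MaxRankSlack A 0 r) {M : Matrix (Fin m) (Fin m) ℝ}
    (hM : IsUnit M) :
    ElemReform r hr A 0 (fun i => ∑ j, M i j • A j) (Zmat n r) ∧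
      MaxRankSlack (fun i => ∑ j, M i j • A j) (Zmat n r) r := by
  obtain ⟨⟨z, hz⟩, hmax⟩ := hZ
  refine ⟨⟨M, -z, 1, hM, ?_, ?_, ?_⟩, ⟨0, by simp⟩, fun x hx => ?_⟩
  · rw [Tmat_one]; exact isUnit_one
  · simp [Tmat_one]
  · simp [Tmat_one, ← hz]
  · have key : Zmat n r - ∑ i, x i • ∑ j, M i j • A j =
        0 - ∑ j, (z + x ᵥ* M) j • A j := by
      rw [reformulation_combination, ← hz]
      simp only [Pi.add_apply, add_smul, Finset.sum_add_distrib]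
      abel
    rw [IsFeasible] at hx
    rw [key] at hx ⊢
    exact hmax _ hx

lemma not_spanCond_iff_exists_badNormalForm (hA : ∀ i, (A i).IsSymm) (hZ : MaxRankSlack A 0 r) :
    ¬ SpanCond A r hr ↔
      ∃ (A' : Fin m → Matrix (Fin n) (Fin n) ℝ) (B' : Matrix (Fin n) (Fin n) ℝ),
        ElemReform r hr A 0 A' B' ∧ BadNormalForm A' B' r hr := by
  constructor
  · intro hbad
    simp only [SpanCond, not_forall] at hbad
    obtain ⟨v, hv22, hv⟩ := hbad
    obtain ⟨M, k, hk, hM, hker, hli, hlast⟩ := exists_isUnit_adapted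
      (lastColsLinear hr ∘ₗ Fintype.linearCombination ℝ A) (v := v) hv
    obtain ⟨href, hmax⟩ := hZ.exists_elemReform hr hM
    have hzero : ∀ i : Fin m, (i : ℕ) < k → ∀ a b : Fin n, r ≤ (b : ℕ) →
        (∑ j, M i j • A j) a b = 0 := fun i hi => (lastCols_eq_zero_iff hr).1 (hker i hi)
    refine ⟨_, _, href, rfl, hmax, k, hk, hzero, fun i hi a b ha => ?_, hli, ?_⟩
    · exact ((isSymm_sum_smul hA (M i)).apply b a).trans (hzero i hi b a ha)
    · simpa only [hlast] using hv22
  · rintro ⟨A', B', ⟨M, μ, N, hM, hT, hA', -⟩, -, -, k, hk, -, -, hli, hpsd⟩ hG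
    have hN := isUnit_of_isUnit_Tmat hr hT
    rw [hA', block22_transpose_mul_mul_Tmat] at hpsd
    have h0 := hG (M ⟨m - 1, by omega⟩)
      (hN.posSemidef_star_left_conjugate_iff.1 (by simpa [star_eq_conjTranspose] using hpsd))
    refine hli.ne_zero ⟨m - 1 - k, by omega⟩ ?_
    have hidx : (⟨k + (m - 1 - k), by omega⟩ : Fin m) = ⟨m - 1, by omega⟩ := by
      ext; simp; omega
    simp only [hidx]
    rw [hA', lastCols_mul_Tmat, lastCols_mul, h0, Matrix.mul_zero, Matrix.zero_mul]

lemma spanCond_iff_exists_goodNormalForm (hA : ∀ i, (A i).IsSymm) (hZ : MaxRankSlack A 0 r) :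
    SpanCond A r hr ↔
      ∃ (A' : Fin m → Matrix (Fin n) (Fin n) ℝ) (B' : Matrix (Fin n) (Fin n) ℝ),
        ElemReform r hr A 0 A' B' ∧ GoodNormalForm A' B' r hr := by
  constructor
  · intro hG
    let B := block22Linear hr ∘ₗ Fintype.linearCombination ℝ A
    have hB0 : ∀ x, B x = 0 → lastCols r hr (∑ i, x i • A i) = 0 := fun x hx =>
      hG x (by rw [show block22 r hr (∑ i, x i • A i) = 0 from hx]; exact .zero)
    obtain ⟨U, hU, hUB⟩ := exists_posDef_forall_trace_mul_eq_zero B fun x hx =>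
      block22_eq_zero_of_lastCols_eq_zero hr (hG x hx)
    have hadapted : ∃ (M : Matrix (Fin m) (Fin m) ℝ) (k : ℕ) (hk : k ≤ m), IsUnit M ∧
        (∀ i : Fin m, (i : ℕ) < k → B (M i) = 0) ∧
        LinearIndependent ℝ (fun i : Fin (m - k) => B (M ⟨k + i.1, by omega⟩)) := by
      by_cases hB : ∃ v, B v ≠ 0
      · obtain ⟨v, hv⟩ := hB
        obtain ⟨M, k, hk, hM, hker, hli, -⟩ := exists_isUnit_adapted B hv
        exact ⟨M, k, hk.le, hM, hker, hli⟩
      · push Not at hB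
        have : IsEmpty (Fin (m - m)) := by rw [Nat.sub_self]; infer_instance
        exact ⟨1, m, le_rfl, isUnit_one, fun i _ => hB _, linearIndependent_empty_type⟩
    obtain ⟨M, k, hk, hM, hker, hli⟩ := hadapted
    obtain ⟨href, hmax⟩ := hZ.exists_elemReform hr hM
    refine ⟨_, _, href, rfl, hmax, k, hk, fun i hi a b hab => ?_, hli, U, hU, fun i _ => ?_⟩
    · have h0 := (lastCols_eq_zero_iff hr).1 (hB0 _ (hker i hi))
      rcases hab with ha | hb
      · exact ((isSymm_sum_smul hA (M i)).apply b a).trans (h0 b a ha)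
      · exact h0 a b hb
    · rw [ip, trace_mul_comm]
      refine hUB (M i) ?_
      ext a b
      exact (isSymm_sum_smul hA (M i)).apply _ _
  · rintro ⟨A', B', ⟨M, μ, N, hM, hT, hA', -⟩, -, -, k, hk, hzero, hli, U, hU, hUA⟩ x hx
    obtain ⟨M', hM'⟩ := hM.exists_left_inv
    set c := x ᵥ* M' with hc
    have hcomb : ∑ i, x i • A i = ∑ i, c i • ∑ j, M i j • A j := by
      rw [reformulation_combination, hc, vecMul_vecMul, hM', vecMul_one]
    have hW : (Tmat r hr N)ᵀ * (∑ i, x i • A i) * Tmat r hr N = ∑ i, c i • A' i := by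
      rw [hcomb, Finset.mul_sum, Finset.sum_mul]
      simp [hA']
    refine lastCols_eq_zero_of_transpose_mul_mul_Tmat hr hT ?_
    have hpsd : (block22 r hr (∑ i, c i • A' i)).PosSemidef := by
      rw [← hW, block22_transpose_mul_mul_Tmat]
      simpa using hx.conjTranspose_mul_mul_same N
    have hlast0 : ∀ i : Fin m, (i : ℕ) < k → lastCols r hr (A' i) = 0 := fun i hi =>
      (lastCols_eq_zero_iff hr).2 fun a b hb => hzero i hi a b (.inr hb)
    have hsum22 : block22 r hr (∑ i, c i • A' i) = ∑ i, c i • block22 r hr (A' i) := by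
      exact map_sum (block22Linear hr) (fun i => c i • A' i) Finset.univ
    have h0 : block22 r hr (∑ i, c i • A' i) = 0 := by
      refine hU.eq_zero_of_trace_mul_eq_zero hpsd ?_
      rw [hsum22, Finset.mul_sum, trace_sum]
      refine Finset.sum_eq_zero fun i _ => ?_
      rw [Matrix.mul_smul, trace_smul, trace_mul_comm]
      rcases lt_or_ge (i : ℕ) k with hi | hi
      · simp [block22_eq_zero_of_lastCols_eq_zero hr (hlast0 i hi)]
      · rw [← ip, hUA i hi, smul_zero]
    have hcz : ∀ i : Fin (m - k), c ⟨k + i, by omega⟩ = 0 := by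
      refine Fintype.linearIndependent_iff.1 hli (fun i => c ⟨k + i, by omega⟩) ?_
      rw [hsum22, ← (splitEquiv hk).sum_comp, Fintype.sum_sum_type] at h0
      rw [← h0]
      refine (add_eq_right.2 <| Finset.sum_eq_zero fun i _ => ?_).symm
      rw [block22_eq_zero_of_lastCols_eq_zero hr (hlast0 _ i.2), smul_zero]
    have hsumlast : lastCols r hr (∑ i, c i • A' i) = ∑ i, c i • lastCols r hr (A' i) := by
      exact map_sum (lastColsLinear hr) (fun i => c i • A' i) Finset.univ
    rw [hW, hsumlast]
    refine Finset.sum_eq_zero fun i _ => ?_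
    obtain ⟨i | i, rfl⟩ := (splitEquiv hk).surjective i
    · rw [hlast0 _ i.2, smul_zero]
    · rw [splitEquiv_inr, hcz, zero_smul]

end Systems

/-- If `Z = diag(I_r, 0)` is a maximum rank slack of the
homogeneous system `∑ xᵢ Aᵢ ⪯ 0`, then the image of the psd cone under
`Y ↦ (A₁ • Y, …, A_m • Y)` is (1) not closed iff the homogeneous system has an
elementary reformulation in bad normal form, and (2) closed iff it has an
elementary reformulation in good normal form. -/
theorem stmt15 {n m : ℕ} (hn : 0 < n) (hm : 0 < m)
    (A : Fin m → Matrix (Fin n) (Fin n) ℝ) (hA : ∀ i, (A i).IsSymm)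
    (r : ℕ) (hr : r ≤ n)
    (hZ : MaxRankSlack A (0 : Matrix (Fin n) (Fin n) ℝ) r) :
    (¬ IsClosed (imageSet A) ↔
      ∃ (A' : Fin m → Matrix (Fin n) (Fin n) ℝ) (B' : Matrix (Fin n) (Fin n) ℝ),
        ElemReform r hr A (0 : Matrix (Fin n) (Fin n) ℝ) A' B' ∧
        BadNormalForm A' B' r hr) ∧
    (IsClosed (imageSet A) ↔
      ∃ (A' : Fin m → Matrix (Fin n) (Fin n) ℝ) (B' : Matrix (Fin n) (Fin n) ℝ),
        ElemReform r hr A (0 : Matrix (Fin n) (Fin n) ℝ) A' B' ∧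
        GoodNormalForm A' B' r hr) := by
  rw [isClosed_imageSet_iff hr hA hZ]
  exact ⟨not_spanCond_iff_exists_badNormalForm hr hA hZ,
    spanCond_iff_exists_goodNormalForm hr hA hZ⟩
end

section
/- Let A_1,…,A_m be real symmetric n×n matrices, 𝒜*(Y) = (A_1•Y, …, A_m•Y), and c ∈ ℝ^m. Then c lies in the frontier of 𝒜*(PSD^n) if and only if both of the following hold: (a) there is no symmetric positive semidefinite Y with A_i•Y = c_i for all i; and (b) the alternative system is infeasible, i.e., there is no x ∈ ℝ^m with Σ c_i x_i = 1 and Σ x_i A_i ⪯ 0. -/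
open Matrix

theorem ip_vecMulVec {k : ℕ} (S : Matrix (Fin k) (Fin k) ℝ) (v w : Fin k → ℝ) :
    ip S (vecMulVec v w) = w ⬝ᵥ (S *ᵥ v) := by
  rw [ip, mul_vecMulVec, trace_vecMulVec, dotProduct_comm]

theorem ip_sum_smul_left {n m : ℕ} (A : Fin m → Matrix (Fin n) (Fin n) ℝ) (x : Fin m → ℝ)
    (Y : Matrix (Fin n) (Fin n) ℝ) : ip (∑ i, x i • A i) Y = ∑ i, x i * ip (A i) Y := by
  simp [ip, Finset.sum_mul, trace_sum]

theorem ip_neg_left {k : ℕ} (S T : Matrix (Fin k) (Fin k) ℝ) : ip (-S) T = -ip S T := by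
  simp [ip]

theorem ip_nonneg {k : ℕ} {S Y : Matrix (Fin k) (Fin k) ℝ} (hS : S.PosSemidef)
    (hY : Y.PosSemidef) : 0 ≤ ip S Y := by
  obtain ⟨r, v, rfl⟩ := posSemidef_iff_eq_sum_vecMulVec.mp hY
  rw [ip, Finset.mul_sum, trace_sum]
  refine Finset.sum_nonneg fun i _ => ?_
  change 0 ≤ ip S _
  rw [ip_vecMulVec]
  exact hS.dotProduct_mulVec_nonneg (v i)

/-- Self-duality of the positive semidefinite cone. -/
theorem posSemidef_of_forall_ip_nonneg {k : ℕ} {S : Matrix (Fin k) (Fin k) ℝ} (hS : S.IsSymm)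
    (h : ∀ Y : Matrix (Fin k) (Fin k) ℝ, Y.PosSemidef → 0 ≤ ip S Y) : S.PosSemidef := by
  refine .of_dotProduct_mulVec_nonneg (by simpa [IsHermitian, IsSymm] using hS) fun v => ?_
  rw [← ip_vecMulVec]
  exact h _ (posSemidef_vecMulVec_self_star v)

theorem zero_mem_imageSet {n m : ℕ} (A : Fin m → Matrix (Fin n) (Fin n) ℝ) :
    (0 : Fin m → ℝ) ∈ imageSet A :=
  ⟨0, .zero, by simp [ip]⟩

theorem smul_mem_imageSet {n m : ℕ} {A : Fin m → Matrix (Fin n) (Fin n) ℝ} {y : Fin m → ℝ}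
    (hy : y ∈ imageSet A) {t : ℝ} (ht : 0 ≤ t) : t • y ∈ imageSet A := by
  obtain ⟨Y, hY, h⟩ := hy
  exact ⟨t • Y, hY.smul ht, fun i => by simp [← h, ip]⟩

theorem convex_imageSet {n m : ℕ} (A : Fin m → Matrix (Fin n) (Fin n) ℝ) :
    Convex ℝ (imageSet A) := by
  rintro y ⟨Y, hY, hy⟩ z ⟨Z, hZ, hz⟩ a b ha hb -
  exact ⟨a • Y + b • Z, (hY.smul ha).add (hZ.smul hb),
    fun i => by simp [← hy, ← hz, ip, mul_add]⟩

theorem sum_mul_nonpos_of_mem_closure {n m : ℕ} {A : Fin m → Matrix (Fin n) (Fin n) ℝ}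
    {c x : Fin m → ℝ} (hc : c ∈ closure (imageSet A))
    (hx : (-∑ i, x i • A i).PosSemidef) : ∑ i, c i * x i ≤ 0 := by
  have hclosed : IsClosed {y : Fin m → ℝ | ∑ i, y i * x i ≤ 0} :=
    isClosed_le (by fun_prop) continuous_const
  refine closure_minimal ?_ hclosed hc
  rintro y ⟨Y, hY, hy⟩
  have h := ip_nonneg hx hY
  rw [ip_neg_left, ip_sum_smul_left] at h
  simp only [hy, mul_comm (x _)] at h
  exact neg_nonneg.mp h

theorem exists_alternative_of_notMem_closure {n m : ℕ} {A : Fin m → Matrix (Fin n) (Fin n) ℝ}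
    (hA : ∀ i, (A i).IsSymm) {c : Fin m → ℝ} (hc : c ∉ closure (imageSet A)) :
    ∃ x : Fin m → ℝ, ∑ i, c i * x i = 1 ∧ (-∑ i, x i • A i).PosSemidef := by
  obtain ⟨f, u, hf, hu⟩ :=
    geometric_hahn_banach_closed_point (convex_imageSet A).closure isClosed_closure hc
  have hu0 : 0 < u := by simpa using hf 0 (subset_closure (zero_mem_imageSet A))
  have hfc : 0 < f c := hu0.trans hu
  have hnonpos : ∀ y ∈ imageSet A, f y ≤ 0 := by
    intro y hy
    by_contra! hpos
    have h := hf _ (subset_closure (smul_mem_imageSet hy (div_pos hu0 hpos).le))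
    simp [hpos.ne'] at h
  have hrepr : ∀ y : Fin m → ℝ, f y = ∑ i, y i * f (Pi.single i 1) := fun y => by
    conv_lhs => rw [← Finset.univ_sum_single y]
    rw [map_sum]
    refine Finset.sum_congr rfl fun i _ => ?_
    rw [← smul_eq_mul, ← map_smul, ← Pi.single_smul, smul_eq_mul, mul_one]
  refine ⟨fun i => f (Pi.single i 1) / f c, ?_, posSemidef_of_forall_ip_nonneg ?_ fun Y hY => ?_⟩
  · simp_rw [← mul_div_assoc, ← Finset.sum_div, ← hrepr]
    exact div_self hfc.ne'
  · simp only [IsSymm, transpose_neg, transpose_sum, transpose_smul, (hA _).eq]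
  · have h := hnonpos (fun i => ip (A i) Y) ⟨Y, hY, fun _ => rfl⟩
    rw [ip_neg_left, ip_sum_smul_left, neg_nonneg]
    simp_rw [div_mul_eq_mul_div, ← Finset.sum_div, mul_comm (f (Pi.single _ _))]
    rw [← hrepr]
    exact div_nonpos_of_nonpos_of_nonneg h hfc.le

/-- `c` lies in the frontier of the image of the psd cone iff
(a) no psd `Y` has `Aᵢ • Y = cᵢ` for all `i`, and (b) the alternative system
`∑ cᵢ xᵢ = 1`, `∑ xᵢ Aᵢ ⪯ 0` is infeasible. -/
theorem stmt17 {n m : ℕ} (hn : 0 < n) (hm : 0 < m)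
    (A : Fin m → Matrix (Fin n) (Fin n) ℝ) (hA : ∀ i, (A i).IsSymm)
    (c : Fin m → ℝ) :
    c ∈ closure (imageSet A) \ imageSet A ↔
      (¬ ∃ Y : Matrix (Fin n) (Fin n) ℝ, Y.PosSemidef ∧ ∀ i, ip (A i) Y = c i) ∧
      (¬ ∃ x : Fin m → ℝ, (∑ i, c i * x i) = 1 ∧ (- ∑ i, x i • A i).PosSemidef) := by
  refine ⟨fun ⟨hc, hc'⟩ => ⟨hc', ?_⟩, fun ⟨ha, hb⟩ => ⟨?_, ha⟩⟩
  · rintro ⟨x, hx, hpsd⟩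
    linarith [sum_mul_nonpos_of_mem_closure hc hpsd]
  · by_contra hc
    exact hb (exists_alternative_of_notMem_closure hA hc)
end
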